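/- arXiv:0912.5353 — 4 statements merged into one kernel-verified Lean document; each statement's English description precedes it below -/
import Mathlib

section
/- Fix μ > 0 and let g(L, k) = (L/μ)·exp(−k(1/L − 1/μ)). Then g is jointly convex in (L, k) on the set {(L, k) : 0 < L < μ, k ≥ L²/(2(μ − L))}. -/
open Real

lemma convex_sq_div_le (μ : ℝ) :
    Convex ℝ {p : ℝ × ℝ | 0 < p.1 ∧ p.1 < μ ∧ p.1 ^ 2 / (2 * (μ - p.1)) ≤ p.2} := by
  rintro ⟨x, k⟩ ⟨hx, hxμ, hk⟩ ⟨y, l⟩ ⟨hy, hyμ, hl⟩ a b ha hb hab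
  have tangent : ∀ s z m : ℝ, z < μ → z ^ 2 / (2 * (μ - z)) ≤ m →
      s * z - s ^ 2 * (μ - z) / 2 ≤ m := by
    intro s z m hz hm
    have hu : 0 < μ - z := sub_pos.2 hz
    refine le_trans ?_ hm
    rw [le_div_iff₀ (by positivity)]
    nlinarith [sq_nonneg (z - s * (μ - z))]
  have hz : (a • x + b • y) ∈ Set.Ioo 0 μ :=
    convex_Ioo 0 μ ⟨hx, hxμ⟩ ⟨hy, hyμ⟩ ha hb hab
  refine ⟨hz.1, hz.2, ?_⟩
  simp only [Prod.smul_mk, Prod.mk_add_mk, smul_eq_mul, Set.mem_Ioo] at *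
  set z := a * x + b * y with hzdef
  have hu : 0 < μ - z := sub_pos.2 hz.2
  set s := z / (μ - z) with hs
  have key : z ^ 2 / (2 * (μ - z)) = s * z - s ^ 2 * (μ - z) / 2 := by
    rw [hs]; field_simp; ring
  have h₁ := mul_le_mul_of_nonneg_left (tangent s x k hxμ hk) ha
  have h₂ := mul_le_mul_of_nonneg_left (tangent s y l hyμ hl) hb
  have h₃ : s * z - s ^ 2 * (μ - z) / 2 =
      a * (s * x - s ^ 2 * (μ - x) / 2) + b * (s * y - s ^ 2 * (μ - y) / 2) := by
    rw [hzdef]; linear_combination (s ^ 2 * μ / 2) * hab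
  rw [key, h₃]
  exact add_le_add h₁ h₂

lemma hessian_form_nonneg {μ L k : ℝ} (hL : 0 < L) (hLμ : L < μ)
    (hk : L ^ 2 / (2 * (μ - L)) ≤ k) (d e : ℝ) :
    0 ≤ k ^ 2 / L ^ 3 * d ^ 2 + 2 * (1 / μ - k * (1 / L - 1 / μ) / L) * d * e
      + (1 / L - 1 / μ) ^ 2 * L * e ^ 2 := by
  have hμ : 0 < μ := hL.trans hLμ
  have hu : 0 < μ - L := sub_pos.2 hLμ
  rw [div_le_iff₀ (by positivity)] at hk
  have h : k ^ 2 / L ^ 3 * d ^ 2 + 2 * (1 / μ - k * (1 / L - 1 / μ) / L) * d * e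
      + (1 / L - 1 / μ) ^ 2 * L * e ^ 2 =
      ((μ * k * d - (μ - L) * L * e) ^ 2 + 2 * μ * L ^ 3 * (d * e)) / (μ ^ 2 * L ^ 3) := by
    field_simp; ring
  rw [h]
  refine div_nonneg ?_ (by positivity)
  rcases le_total 0 (d * e) with hde | hde
  · positivity
  · have := mul_nonneg (mul_nonneg (mul_pos hμ hL).le (sub_nonneg.2 hk)) (neg_nonneg.2 hde)
    nlinarith [sq_nonneg (μ * k * d + (μ - L) * L * e)]

lemma hasDerivAt_exponent {μ l d k e t : ℝ} (hL : l + t * d ≠ 0) :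
    HasDerivAt (fun t => Real.exp (-(k + t * e) * (1 / (l + t * d) - 1 / μ)))
      (Real.exp (-(k + t * e) * (1 / (l + t * d) - 1 / μ)) *
        (-e * (1 / (l + t * d) - 1 / μ) + (k + t * e) * d / (l + t * d) ^ 2)) t := by
  have h₁ : HasDerivAt (fun t => l + t * d) d t := by
    simpa using ((hasDerivAt_id t).mul_const d).const_add l
  have h₂ : HasDerivAt (fun t => k + t * e) e t := by
    simpa using ((hasDerivAt_id t).mul_const e).const_add k
  have h₃ := (h₂.neg.mul ((h₁.inv hL).sub_const (1 / μ))).exp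
  convert h₃ using 1
  · ext t; simp
  · simp; ring

lemma convexOn_loss_segment {μ l d k e : ℝ}
    (h : ∀ t ∈ Set.Icc (0 : ℝ) 1, 0 < l + t * d ∧ l + t * d < μ ∧
      (l + t * d) ^ 2 / (2 * (μ - (l + t * d))) ≤ k + t * e) :
    ConvexOn ℝ (Set.Icc (0 : ℝ) 1) fun t =>
      (l + t * d) / μ * Real.exp (-(k + t * e) * (1 / (l + t * d) - 1 / μ)) := by
  have hμ : 0 < μ := by
    obtain ⟨h₀, h₁, -⟩ := h 0 (by simp)
    exact h₀.trans h₁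
  have hl : ∀ t : ℝ, HasDerivAt (fun t => l + t * d) d t := fun t => by
    simpa using ((hasDerivAt_id t).mul_const d).const_add l
  have hk : ∀ t : ℝ, HasDerivAt (fun t => k + t * e) e t := fun t => by
    simpa using ((hasDerivAt_id t).mul_const e).const_add k
  have hf' : ∀ t ∈ Set.Icc (0 : ℝ) 1, HasDerivAt
      (fun t => (l + t * d) / μ * Real.exp (-(k + t * e) * (1 / (l + t * d) - 1 / μ)))
      (Real.exp (-(k + t * e) * (1 / (l + t * d) - 1 / μ)) *
        (((1 + (k + t * e) * (l + t * d)⁻¹) * d + ((l + t * d) / μ - 1) * e) / μ)) t := by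
    intro t ht
    have hL := (h t ht).1.ne'
    refine (((hl t).div_const μ).mul
      (hasDerivAt_exponent (μ := μ) (k := k) (e := e) hL)).congr_deriv ?_
    generalize Real.exp _ = E
    generalize l + t * d = L at hL ⊢
    field_simp
    ring
  have hf'' : ∀ t ∈ Set.Icc (0 : ℝ) 1, HasDerivAt
      (fun t => Real.exp (-(k + t * e) * (1 / (l + t * d) - 1 / μ)) *
        (((1 + (k + t * e) * (l + t * d)⁻¹) * d + ((l + t * d) / μ - 1) * e) / μ))
      (Real.exp (-(k + t * e) * (1 / (l + t * d) - 1 / μ)) / μ *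
        ((k + t * e) ^ 2 / (l + t * d) ^ 3 * d ^ 2
          + 2 * (1 / μ - (k + t * e) * (1 / (l + t * d) - 1 / μ) / (l + t * d)) * d * e
          + (1 / (l + t * d) - 1 / μ) ^ 2 * (l + t * d) * e ^ 2)) t := by
    intro t ht
    have hL := (h t ht).1.ne'
    refine ((hasDerivAt_exponent (μ := μ) (k := k) (e := e) hL).mul
      ((((((hk t).mul ((hl t).inv hL)).const_add 1).mul_const d).add
        ((((hl t).div_const μ).sub_const 1).mul_const e)).div_const μ)).congr_deriv ?_
    simp only [Pi.add_apply, Pi.mul_apply, Pi.inv_apply]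
    generalize Real.exp _ = E
    field_simp
    ring
  refine convexOn_of_hasDerivWithinAt2_nonneg (convex_Icc 0 1)
    (fun t ht => (hf' t ht).continuousAt.continuousWithinAt)
    (fun t ht => (hf' t (interior_subset ht)).hasDerivWithinAt)
    (fun t ht => (hf'' t (interior_subset ht)).hasDerivWithinAt) fun t ht => ?_
  obtain ⟨h₀, h₁, h₂⟩ := h t (interior_subset ht)
  exact mul_nonneg (by positivity) (hessian_form_nonneg h₀ h₁ h₂ d e)

/-- For fixed `μ > 0`, the per-hop queueing packet-loss probability
`g(L,k) = (L/μ)·exp(−k(1/L − 1/μ))` is jointly convex in `(L,k)` on the set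
`{(L,k) : 0 < L < μ, k ≥ L²/(2(μ − L))}`. -/
theorem stmt_1 (μ : ℝ) (hμ : 0 < μ) :
    ConvexOn ℝ
      {p : ℝ × ℝ | 0 < p.1 ∧ p.1 < μ ∧ p.1 ^ 2 / (2 * (μ - p.1)) ≤ p.2}
      (fun p : ℝ × ℝ => p.1 / μ * Real.exp (-p.2 * (1 / p.1 - 1 / μ))) := by
  refine ⟨convex_sq_div_le μ, ?_⟩
  rintro ⟨x, k⟩ hp ⟨y, l⟩ hq a b ha hb hab
  have hseg : ∀ t ∈ Set.Icc (0 : ℝ) 1, 0 < x + t * (y - x) ∧ x + t * (y - x) < μ ∧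
      (x + t * (y - x)) ^ 2 / (2 * (μ - (x + t * (y - x)))) ≤ k + t * (l - k) := fun t ht => by
    simpa using (convex_sq_div_le μ).add_smul_sub_mem hp hq ht
  have hconv := (convexOn_loss_segment hseg).2 (Set.left_mem_Icc.2 zero_le_one)
    (Set.right_mem_Icc.2 zero_le_one) ha hb hab
  have hx : a * x + b * y = x + b * (y - x) := by linear_combination x * hab
  have hk : a * k + b * l = k + b * (l - k) := by linear_combination k * hab
  simpa [hx, hk] using hconv
end

section
/- Fix N ≥ 2, μ > 0, ρ > 1, r > 0, and for each i = 1, …, N−1 let f_i(x) = a_i − b_i x with a_i ∈ ℝ and b_i ≥ 0. Define P_e({L_i}, {k_i}) = Σ_{i=1}^{N−1} [ ρ^{−f_i(r/L_i)} + (L_i/μ)·exp(−k_i(1/L_i − 1/μ)) ]. Then P_e is jointly convex in the 2(N−1) variables (L_1, …, L_{N−1}, k_1, …, k_{N−1}) on the convex set {(L_i, k_i) : 0 < L_i < μ and k_i > L_i/(2(μ/L_i − 1)) for every i = 1, …, N−1}. -/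
open Real Finset

/-- The region of pairs (rounds, deadline) on which the deadline-violation probability
of an M/M/1 queue with mean inter-arrival time `μ` is convex. -/
def queueRegion (μ : ℝ) : Set (ℝ × ℝ) :=
  {p | 0 < p.1 ∧ p.1 < μ ∧ p.1 / (2 * (μ / p.1 - 1)) < p.2}

lemma mem_queueRegion {μ : ℝ} {p : ℝ × ℝ} :
    p ∈ queueRegion μ ↔ 0 < p.1 ∧ p.1 < μ ∧ p.1 ^ 2 < 2 * p.2 * (μ - p.1) := by
  refine and_congr_right fun h0 => and_congr_right fun h1 => ?_
  have e : p.1 / (2 * (μ / p.1 - 1)) = p.1 ^ 2 / (2 * (μ - p.1)) := by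
    have : μ - p.1 ≠ 0 := by linarith
    have : μ / p.1 - 1 = (μ - p.1) / p.1 := by field_simp
    rw [this]
    field_simp
  rw [e, div_lt_iff₀ (by linarith)]
  ring_nf

lemma snd_pos_of_mem_queueRegion {μ : ℝ} {p : ℝ × ℝ} (hp : p ∈ queueRegion μ) : 0 < p.2 := by
  obtain ⟨h0, h1, h2⟩ := mem_queueRegion.1 hp
  by_contra! h
  nlinarith [mul_nonneg (neg_nonneg.2 h) (sub_nonneg.2 h1.le), pow_pos h0 2]

lemma convex_queueRegion (μ : ℝ) : Convex ℝ (queueRegion μ) := by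
  refine convex_iff_forall_pos.2 fun x hx y hy s t hs ht hst => ?_
  have kx := snd_pos_of_mem_queueRegion hx
  have ky := snd_pos_of_mem_queueRegion hy
  obtain ⟨x0, x1, x2⟩ := mem_queueRegion.1 hx
  obtain ⟨y0, y1, y2⟩ := mem_queueRegion.1 hy
  obtain ⟨L, k⟩ := x
  obtain ⟨L', k'⟩ := y
  simp only at *
  have hm : 0 < μ - L := by linarith
  have hm' : 0 < μ - L' := by linarith
  have cross : L * L' ≤ k * (μ - L') + k' * (μ - L) := by
    refine (sq_le_sq₀ (by positivity) (by positivity)).1 ?_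
    have := mul_le_mul x2.le y2.le (by positivity) (by positivity)
    nlinarith [sq_nonneg (k * (μ - L') - k' * (μ - L))]
  have hμ : μ = s * μ + t * μ := by rw [← add_mul, hst, one_mul]
  refine mem_queueRegion.2 ⟨?_, ?_, ?_⟩ <;>
    simp only [Prod.smul_mk, Prod.mk_add_mk, smul_eq_mul]
  · positivity
  · rw [hμ]; gcongr
  · have e : μ - (s * L + t * L') = s * (μ - L) + t * (μ - L') := by linarith
    rw [e]
    have h1 := mul_lt_mul_of_pos_left x2 (pow_pos hs 2)
    have h2 := mul_lt_mul_of_pos_left y2 (pow_pos ht 2)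
    have h3 := mul_le_mul_of_nonneg_left cross (by positivity : 0 ≤ 2 * (s * t))
    linarith

/-- A binary quadratic form whose cross coefficient is dominated by its diagonal is nonnegative. -/
lemma quadratic_nonneg_of_abs_le {α β q u v : ℝ} (hq : |q| ≤ α * β) :
    0 ≤ (α * u) ^ 2 + 2 * q * (u * v) + (β * v) ^ 2 := by
  obtain ⟨h1, h2⟩ := abs_le.1 hq
  rcases le_total 0 (u * v) with h | h
  · nlinarith [mul_le_mul_of_nonneg_right h1 h, sq_nonneg (α * u - β * v)]
  · nlinarith [mul_le_mul_of_nonpos_right h2 h, sq_nonneg (α * u + β * v)]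

lemma convexOn_queue_delay {μ : ℝ} (hμ : 0 < μ) :
    ConvexOn ℝ (queueRegion μ)
      (fun p => p.1 / μ * Real.exp (-p.2 * (1 / p.1 - 1 / μ))) := by
  refine ⟨convex_queueRegion μ, fun x hx y hy s t hs ht hst => ?_⟩
  obtain ⟨L₀, k₀⟩ := x
  obtain ⟨L₁, k₁⟩ := y
  set u := L₁ - L₀ with hu
  set v := k₁ - k₀ with hv
  set L : ℝ → ℝ := fun z => L₀ + z * u with hL
  set k : ℝ → ℝ := fun z => k₀ + z * v with hk
  have mem : ∀ z ∈ Set.Icc (0 : ℝ) 1, (L z, k z) ∈ queueRegion μ := by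
    intro z hz
    convert convex_queueRegion μ hx hy (sub_nonneg.2 hz.2) hz.1 (by ring) using 1
    ext <;> simp [hL, hk, hu, hv] <;> ring
  have dL : ∀ z, HasDerivAt L u z := fun z =>
    (((hasDerivAt_id z).mul_const u).const_add L₀).congr_deriv (one_mul u)
  have dk : ∀ z, HasDerivAt k v z := fun z =>
    (((hasDerivAt_id z).mul_const v).const_add k₀).congr_deriv (one_mul v)
  have dE : ∀ z, L z ≠ 0 → HasDerivAt (fun z => Real.exp (-k z * (1 / L z - 1 / μ)))
      (Real.exp (-k z * (1 / L z - 1 / μ)) * (-v * (1 / L z - 1 / μ) + k z * u / L z ^ 2)) z := by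
    intro z hz
    have := ((dk z).neg.mul (((hasDerivAt_const z (1 : ℝ)).div (dL z) hz).sub_const (1 / μ))).exp
    refine this.congr_deriv ?_
    simp only [Pi.mul_apply, Pi.neg_apply, Pi.div_apply]
    ring
  have d1 : ∀ z, L z ≠ 0 → HasDerivAt (fun z => L z / μ * Real.exp (-k z * (1 / L z - 1 / μ)))
      ((u - v + k z * u / L z + v * L z / μ) / μ * Real.exp (-k z * (1 / L z - 1 / μ))) z := by
    intro z hz
    refine (((dL z).div_const μ).mul (dE z hz)).congr_deriv ?_
    field_simp
    ring
  have d2 : ∀ z, L z ≠ 0 → HasDerivAt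
      (fun z => (u - v + k z * u / L z + v * L z / μ) / μ
        * Real.exp (-k z * (1 / L z - 1 / μ)))
      (L z / μ * ((k z / L z ^ 2 * u) ^ 2
        + 2 * ((L z / μ - k z * (1 / L z - 1 / μ)) / L z ^ 2) * (u * v)
        + ((1 / L z - 1 / μ) * v) ^ 2) * Real.exp (-k z * (1 / L z - 1 / μ))) z := by
    intro z hz
    have := ((((((dk z).mul_const u).div (dL z) hz).const_add (u - v)).add
      (((dL z).const_mul v).div_const μ)).div_const μ).mul (dE z hz)
    refine this.congr_deriv ?_
    simp only [Pi.add_apply, Pi.div_apply]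
    field_simp
    ring
  have conv : ConvexOn ℝ (Set.Icc (0 : ℝ) 1)
      (fun z => L z / μ * Real.exp (-k z * (1 / L z - 1 / μ))) := by
    have ne : ∀ z ∈ Set.Icc (0 : ℝ) 1, L z ≠ 0 := fun z hz => (mem z hz).1.ne'
    refine convexOn_of_hasDerivWithinAt2_nonneg (convex_Icc 0 1)
      (fun z hz => (d1 z (ne z hz)).continuousAt.continuousWithinAt)
      (fun z hz => (d1 z (ne z (interior_subset hz))).hasDerivWithinAt)
      (fun z hz => (d2 z (ne z (interior_subset hz))).hasDerivWithinAt) fun z hz => ?_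
    have hz := mem z (interior_subset hz)
    have hk0 := snd_pos_of_mem_queueRegion hz
    obtain ⟨h0, h1, h2⟩ := mem_queueRegion.1 hz
    simp only at h0 h1 h2 hk0
    generalize L z = l at *
    generalize k z = κ at *
    have hc : 1 / l - 1 / μ = (μ - l) / (l * μ) := by field_simp
    have hc0 : 0 ≤ 1 / l - 1 / μ := by
      rw [hc]; exact div_nonneg (by linarith) (by positivity)
    have key : l / μ ≤ 2 * (κ * (1 / l - 1 / μ)) := by
      rw [hc, div_le_iff₀ hμ]
      have : 2 * (κ * ((μ - l) / (l * μ))) * μ = 2 * κ * (μ - l) / l := by field_simp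
      rw [this, le_div_iff₀ h0]
      nlinarith
    have hq : |(l / μ - κ * (1 / l - 1 / μ)) / l ^ 2| ≤ κ / l ^ 2 * (1 / l - 1 / μ) := by
      rw [abs_div, abs_of_pos (pow_pos h0 2), div_mul_eq_mul_div]
      have : 0 < l / μ := by positivity
      gcongr
      exact abs_le.2 ⟨by linarith, by linarith⟩
    have := quadratic_nonneg_of_abs_le (u := u) (v := v) hq
    positivity
  have := conv.2 (Set.left_mem_Icc.2 zero_le_one) (Set.right_mem_Icc.2 zero_le_one) hs ht hst
  have eL : L t = s * L₀ + t * L₁ := by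
    simp only [hL, hu]; linear_combination (-L₀) * hst
  have ek : k t = s * k₀ + t * k₁ := by
    simp only [hk, hv]; linear_combination (-k₀) * hst
  simp only [smul_eq_mul, mul_zero, mul_one, zero_add, eL, ek] at this
  simpa [hL, hk, hu, hv] using this

lemma convexOn_arq_error {ρ r a b : ℝ} (hρ : 1 < ρ) (hr : 0 ≤ r) (hb : 0 ≤ b) :
    ConvexOn ℝ (Set.Ioi 0) (fun x : ℝ => ρ ^ (-(a - b * (r / x)))) := by
  have hlog : 0 ≤ Real.log ρ := (Real.log_pos hρ).le
  have hinv : ConvexOn ℝ (Set.Ioi (0 : ℝ)) (fun x : ℝ => x⁻¹) := by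
    simpa using convexOn_zpow (𝕜 := ℝ) (-1)
  have hexp : ConvexOn ℝ (Set.Ioi (0 : ℝ))
      (fun x : ℝ => (Real.log ρ * b * r) • x⁻¹ + -(Real.log ρ * a)) :=
    (hinv.smul (by positivity)).add_const _
  have hcomp : ConvexOn ℝ (Set.Ioi (0 : ℝ))
      (fun x : ℝ => Real.exp ((Real.log ρ * b * r) • x⁻¹ + -(Real.log ρ * a))) :=
    ⟨hexp.1, fun x hx y hy s t hs ht hst =>
      (Real.exp_le_exp.2 (hexp.2 hx hy hs ht hst)).trans
        (convexOn_exp.2 (Set.mem_univ _) (Set.mem_univ _) hs ht hst)⟩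
  refine hcomp.congr fun x _ => ?_
  simp only [smul_eq_mul]
  rw [Real.rpow_def_of_pos (by linarith)]
  ring_nf

/-- Joint convexity of the total probability of error
`P_e({L_i},{k_i}) = Σ_i [ρ^{−f_i(r/L_i)} + (L_i/μ)·exp(−k_i(1/L_i − 1/μ))]`
(with affine nonincreasing DMT pieces `f_i(x) = a_i − b_i x`) in the `2(N−1)`
variables `(L_1,…,L_{N−1},k_1,…,k_{N−1})` on the set where `0 < L_i < μ` and
`k_i > L_i/(2(μ/L_i − 1))` for every `i`. -/
theorem stmt_4 (N : ℕ) (hN : 2 ≤ N) (μ ρ r : ℝ) (hμ : 0 < μ) (hρ : 1 < ρ) (hr : 0 < r)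
    (a : Fin (N - 1) → ℝ) (b : Fin (N - 1) → ℝ) (hb : ∀ i, 0 ≤ b i) :
    ConvexOn ℝ
      {p : (Fin (N - 1) → ℝ) × (Fin (N - 1) → ℝ) |
        ∀ i, 0 < p.1 i ∧ p.1 i < μ ∧ p.1 i / (2 * (μ / p.1 i - 1)) < p.2 i}
      (fun p => ∑ i, (ρ ^ (-(a i - b i * (r / p.1 i)))
        + p.1 i / μ * Real.exp (-p.2 i * (1 / p.1 i - 1 / μ)))) := by
  set S := {p : (Fin (N - 1) → ℝ) × (Fin (N - 1) → ℝ) |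
    ∀ i, 0 < p.1 i ∧ p.1 i < μ ∧ p.1 i / (2 * (μ / p.1 i - 1)) < p.2 i}
  let pr (i : Fin (N - 1)) : (Fin (N - 1) → ℝ) × (Fin (N - 1) → ℝ) →ₗ[ℝ] ℝ × ℝ :=
    (LinearMap.proj i).prodMap (LinearMap.proj i)
  have hS : Convex ℝ S := by
    have : S = ⋂ i, pr i ⁻¹' queueRegion μ := by
      ext p
      simp [S, pr, queueRegion]
    rw [this]
    exact convex_iInter fun i => (convex_queueRegion μ).linear_preimage (pr i)
  have term (i : Fin (N - 1)) : ConvexOn ℝ S (fun p => ρ ^ (-(a i - b i * (r / p.1 i)))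
      + p.1 i / μ * Real.exp (-p.2 i * (1 / p.1 i - 1 / μ))) :=
    (((convexOn_arq_error hρ hr.le (hb i)).comp_linearMap
      (LinearMap.fst ℝ ℝ ℝ ∘ₗ pr i)).subset (fun p hp => (hp i).1) hS).add
    (((convexOn_queue_delay hμ).comp_linearMap (pr i)).subset (fun p hp => hp i) hS)
  refine ⟨hS, fun x hx y hy s t hs ht hst => ?_⟩
  simp only [smul_eq_mul, Finset.mul_sum, ← Finset.sum_add_distrib]
  exact Finset.sum_le_sum fun i _ => (term i).2 hx hy hs ht hst
end

section
/- Fix μ > 0 and k > 0. The marginal cost function L ↦ (1/μ)·(1 + k/L)·exp(−k(1/L − 1/μ)) is strictly increasing on (0, ∞). -/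
open Real

/-- The function `s ↦ (1 + s)·exp(−s)` is strictly decreasing on `[0,∞)`. -/
theorem strictAntiOn_one_add_mul_exp_neg :
    StrictAntiOn (fun s : ℝ => (1 + s) * Real.exp (-s)) (Set.Ici 0) := by
  intro s hs t _ hst
  have hs : 0 ≤ s := hs
  have hexp : t - s + 1 < Real.exp (t - s) := Real.add_one_lt_exp (sub_pos.2 hst).ne'
  have hlt : 1 + t < (1 + s) * Real.exp (t - s) := by
    nlinarith [mul_nonneg hs (sub_pos.2 hst).le]
  calc (1 + t) * Real.exp (-t)
      < (1 + s) * Real.exp (t - s) * Real.exp (-t) :=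
        mul_lt_mul_of_pos_right hlt (Real.exp_pos _)
    _ = (1 + s) * Real.exp (-s) := by
        rw [mul_assoc, ← Real.exp_add]
        ring_nf

/-- The marginal cost of packet loss due to queueing delay,
`L ↦ (1/μ)·(1 + k/L)·exp(−k(1/L − 1/μ))`, is strictly increasing on `(0,∞)`. -/
theorem stmt_7 (μ k : ℝ) (hμ : 0 < μ) (hk : 0 < k) :
    StrictMonoOn (fun L : ℝ => 1 / μ * (1 + k / L) * Real.exp (-k * (1 / L - 1 / μ)))
      (Set.Ioi 0) := by
  have hfactor (L : ℝ) : 1 / μ * (1 + k / L) * Real.exp (-k * (1 / L - 1 / μ)) =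
      1 / μ * Real.exp (k / μ) * ((1 + k / L) * Real.exp (-(k / L))) := by
    rw [show -k * (1 / L - 1 / μ) = k / μ + -(k / L) by ring, Real.exp_add]
    ring
  intro a ha b hb hab
  simp only [hfactor]
  exact mul_lt_mul_of_pos_left
    (strictAntiOn_one_add_mul_exp_neg (div_pos hk hb).le (div_pos hk ha).le
      (div_lt_div_of_pos_left hk ha hab)) (by positivity)
end

section
/- Let (S_n^{i−1}), (S_n^i), (S_n^{i+1}), (A_n^{i−1}), (A_n^i) and (D_n^{i−1}) be real sequences satisfying: (1) A_n^i = A_n^{i−1} + D_n^{i−1} − D_{n−1}^{i−1} for all n ≥ 1; (2) D_n^i = W_n^i + S_n^i where W_0^i = 0 and W_n^i = (W_{n−1}^i + S_{n−1}^{i+1} − A_n^i)^+. Writing σ^m_{l,p} = Σ_{k=l}^{p} S_k^m and τ^m_{l,p} = Σ_{k=l}^{p} A_k^m (empty sums equal 0), it holds for every n ≥ 0 that D_n^i + D_n^{i−1} = max_{0 ≤ j ≤ n} ( σ^{i+1}_{j, n−1} + S_n^i − τ^{i−1}_{j+1, n} + D_j^{i−1} ). -/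
open Finset

/-- The maximum over `j ≤ n` of `σ_{j,n-1} - τ_{j+1,n} + d_j` is attained, with value `w_n + d_n`,
when `w` satisfies Lindley's recursion with services `s` and inter-arrival times
`a_{n+1} + d_{n+1} - d_n`. -/
lemma isGreatest_lindley_add (s a d w : ℕ → ℝ) (hw0 : w 0 = 0)
    (hw : ∀ n, w (n + 1) = max (w n + s n - (a (n + 1) + d (n + 1) - d n)) 0) (n : ℕ) :
    IsGreatest ((fun j => ∑ k ∈ Finset.Ico j n, s k - ∑ k ∈ Finset.Ioc j n, a k + d j) '' Set.Iic n)
      (w n + d n) := by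
  induction n with
  | zero => simp [hw0, IsGreatest, upperBounds]
  | succ n ih =>
    have step : ∀ j ≤ n,
        ∑ k ∈ Finset.Ico j (n + 1), s k - ∑ k ∈ Finset.Ioc j (n + 1), a k + d j =
          (∑ k ∈ Finset.Ico j n, s k - ∑ k ∈ Finset.Ioc j n, a k + d j) + s n - a (n + 1) := by
      intro j hj
      rw [Finset.sum_Ico_succ_top hj, Finset.sum_Ioc_succ_top hj]
      ring
    obtain ⟨⟨j, hj, hjeq⟩, hub⟩ := ih
    simp only [Set.mem_Iic] at hj hjeq
    constructor
    · rcases max_choice (w n + s n - (a (n + 1) + d (n + 1) - d n)) 0 with h | h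
      · refine ⟨j, Nat.le_succ_of_le hj, ?_⟩
        simp only [step j hj, hw, h, hjeq]
        ring
      · exact ⟨n + 1, Set.self_mem_Iic, by simp [hw, h]⟩
    · rintro _ ⟨i, hi, rfl⟩
      rcases Nat.le_succ_iff.mp hi with hi | rfl
      · have hle := hub ⟨i, hi, rfl⟩
        have hmax := le_max_left (w n + s n - (a (n + 1) + d (n + 1) - d n)) 0
        simp only [step i hi, hw] at hle ⊢
        linarith
      · simp [hw]

/-- Key inductive step for the end-to-end delay of a half-duplex tandem: if
`A^i_n = A^{i−1}_n + D^{i−1}_n − D^{i−1}_{n−1}` for `n ≥ 1`, `W^i` satisfies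
Lindley's recursion with effective service times `S^{i+1}` and inter-arrival
times `A^i`, and `D^i_n = W^i_n + S^i_n`, then for every `n`,
`D^i_n + D^{i−1}_n = max_{0 ≤ j ≤ n} (σ^{i+1}_{j,n−1} + S^i_n − τ^{i−1}_{j+1,n} + D^{i−1}_j)`
where `σ^m_{l,p}` and `τ^m_{l,p}` denote partial sums of `S^m` and `A^m`
(empty sums equal `0`). -/
theorem stmt_13 (Sim1 Si Sip1 Aim1 Ai Dim1 Wi Di : ℕ → ℝ)
    (hA : ∀ n : ℕ, Ai (n + 1) = Aim1 (n + 1) + Dim1 (n + 1) - Dim1 n)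
    (hW0 : Wi 0 = 0)
    (hWrec : ∀ n, Wi (n + 1) = max (Wi n + Sip1 n - Ai (n + 1)) 0)
    (hD : ∀ n, Di n = Wi n + Si n) :
    ∀ n, Di n + Dim1 n =
      (Finset.range (n + 1)).sup' (Finset.nonempty_range_iff.mpr (Nat.succ_ne_zero n))
        (fun j => (∑ k ∈ Finset.Ico j n, Sip1 k) + Si n
          - (∑ k ∈ Finset.Ioc j n, Aim1 k) + Dim1 j) := by
  intro n
  obtain ⟨⟨j, hj, hjeq⟩, hub⟩ :=
    isGreatest_lindley_add Sip1 Aim1 Dim1 Wi hW0 (fun n => by rw [hWrec, hA]) n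
  rw [hD]
  apply le_antisymm
  · refine le_trans (le_of_eq ?_) (Finset.le_sup' _ (Finset.mem_range_succ_iff.mpr hj))
    simp only at hjeq ⊢
    linarith
  · refine Finset.sup'_le _ _ fun i hi => ?_
    have hle := hub ⟨i, Finset.mem_range_succ_iff.mp hi, rfl⟩
    simp only at hle
    linarith
end
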